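/- (Lemma 3, part 3.) Under the consistency setup, let T be nonempty and let γ ⊆ {1,…,p} with γ ⊉ T. Then for every k with 0 < k < 1 there exists a constant c > 1, not depending on n, such that for all sufficiently large n, 𝒫( (1 − R_T²)/(1 − R_γ²) < 1 − 1/c ) > 1 − k. -/

import Mathlib

open MeasureTheory Matrix Filter ENNReal

/-- The submatrix of `X` consisting of the columns indexed by `γ`. -/
noncomputable def designSub {n p : ℕ} (X : Matrix (Fin n) (Fin p) ℝ)
    (γ : Finset (Fin p)) : Matrix (Fin n) {j // j ∈ γ} ℝ :=
  Matrix.of fun i j => X i (j : Fin p)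

/-- The residual projector `Q_γ = I - X_γ(X_γᵀX_γ)⁻¹X_γᵀ` of the submodel `γ`. -/
noncomputable def residProj {n p : ℕ} (X : Matrix (Fin n) (Fin p) ℝ)
    (γ : Finset (Fin p)) : Matrix (Fin n) (Fin n) ℝ :=
  1 - designSub X γ * ((designSub X γ)ᵀ * designSub X γ)⁻¹ * (designSub X γ)ᵀ

/-- The coefficient of determination
`R_γ² = 1 - ‖Q_γ(y-ȳ1)‖²/‖y-ȳ1‖²` of the submodel `γ`. -/
noncomputable def RsqC {n p : ℕ} (X : Matrix (Fin n) (Fin p) ℝ) (γ : Finset (Fin p))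
    (y : Fin n → ℝ) : ℝ :=
  1 - (∑ i, ((residProj X γ).mulVec (fun j => y j - (∑ l, y l) / n) i) ^ 2)
      / (∑ i, (y i - (∑ l, y l) / n) ^ 2)

/-- The response `y = α_T 1 + X β_T + σ_T ε` of the true model. -/
noncomputable def yResp {n p : ℕ} (X : Matrix (Fin n) (Fin p) ℝ) (αT : ℝ)
    (βT : Fin p → ℝ) (σT : ℝ) (ε : Fin n → ℝ) : Fin n → ℝ :=
  fun i => αT + X.mulVec βT i + σT * ε i

/-- The orthogonal projector `X_γ(X_γᵀX_γ)⁻¹X_γᵀ` onto the column space of the submodel `γ`. -/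
noncomputable def hatMatrix {n p : ℕ} (X : Matrix (Fin n) (Fin p) ℝ)
    (γ : Finset (Fin p)) : Matrix (Fin n) (Fin n) ℝ :=
  designSub X γ * ((designSub X γ)ᵀ * designSub X γ)⁻¹ * (designSub X γ)ᵀ

lemma residProj_eq_one_sub_hatMatrix {n p : ℕ} (X : Matrix (Fin n) (Fin p) ℝ)
    (γ : Finset (Fin p)) : residProj X γ = 1 - hatMatrix X γ := rfl

lemma exists_coercive_of_posDef {p : ℕ} {S : Matrix (Fin p) (Fin p) ℝ} (hS : S.PosDef) :
    ∃ c : ℝ, 0 < c ∧ ∀ x : Fin p → ℝ, c * (x ⬝ᵥ x) ≤ x ⬝ᵥ S *ᵥ x := by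
  have hpos : ∀ x : Fin p → ℝ, x ≠ 0 → 0 < x ⬝ᵥ S *ᵥ x := fun x hx => by
    simpa using hS.dotProduct_mulVec_pos hx
  let s : Set (Fin p → ℝ) := Metric.sphere 0 1
  have hs : IsCompact s := isCompact_sphere _ _
  have hc1 : Continuous fun x : Fin p → ℝ => x ⬝ᵥ S *ᵥ x := by fun_prop
  have hc2 : Continuous fun x : Fin p → ℝ => x ⬝ᵥ x := by fun_prop
  have hne : ∀ x ∈ s, x ≠ 0 := fun x hx h => by simp [s, h] at hx
  have hdpos : ∀ x : Fin p → ℝ, x ≠ 0 → 0 < x ⬝ᵥ x := fun x hx =>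
    lt_of_le_of_ne (by simpa using dotProduct_star_self_nonneg x)
      (fun h => hx (dotProduct_self_eq_zero.mp h.symm))
  rcases s.eq_empty_or_nonempty with he | hn
  · refine ⟨1, one_pos, fun x => ?_⟩
    by_cases hx : x = 0
    · simp [hx]
    · have : (‖x‖⁻¹ • x) ∈ s := by simp [s, norm_smul, hx]
      simp [he] at this
  · obtain ⟨z, hz, hmin⟩ := hs.exists_isMinOn hn
      (f := fun x => (x ⬝ᵥ S *ᵥ x) / (x ⬝ᵥ x))
      (hc1.continuousOn.div hc2.continuousOn fun x hx => (hdpos x (hne x hx)).ne')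
    refine ⟨_, div_pos (hpos z (hne z hz)) (hdpos z (hne z hz)), fun x => ?_⟩
    by_cases hx : x = 0
    · simp [hx]
    · have hxs : (‖x‖⁻¹ • x) ∈ s := by simp [s, norm_smul, hx]
      have h := hmin hxs
      have hx0 : ‖x‖ ≠ 0 := by simpa using hx
      simp only [Set.mem_ofPred_eq, mulVec_smul, smul_dotProduct, dotProduct_smul,
        smul_eq_mul] at h
      rw [← le_div_iff₀ (hdpos x hx)]
      refine h.trans (le_of_eq ?_)
      field_simp

lemma abs_dotProduct_mulVec_le {p : ℕ} {D : Matrix (Fin p) (Fin p) ℝ} {η : ℝ}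
    (hD : ∀ i j, |D i j| ≤ η) (x : Fin p → ℝ) :
    |x ⬝ᵥ D *ᵥ x| ≤ η * p * (x ⬝ᵥ x) := by
  have h1 : ∀ i j, |x i * (D i j * x j)| ≤ η * ((x i * x i + x j * x j) / 2) := fun i j => by
    have : |x i * (D i j * x j)| = |D i j| * |x i * x j| := by
      rw [← abs_mul]; congr 1; ring
    rw [this]
    refine mul_le_mul (hD i j) ?_ (abs_nonneg _) ((abs_nonneg _).trans (hD i j))
    rw [abs_le]
    constructor <;> nlinarith [sq_nonneg (x i - x j), sq_nonneg (x i + x j)]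
  calc |x ⬝ᵥ D *ᵥ x| = |∑ i, ∑ j, x i * (D i j * x j)| := by
        simp [dotProduct, mulVec, Finset.mul_sum]
    _ ≤ ∑ i, ∑ j, |x i * (D i j * x j)| :=
        (Finset.abs_sum_le_sum_abs _ _).trans
          (Finset.sum_le_sum fun i _ => Finset.abs_sum_le_sum_abs _ _)
    _ ≤ ∑ i, ∑ j, η * ((x i * x i + x j * x j) / 2) :=
        Finset.sum_le_sum fun i _ => Finset.sum_le_sum fun j _ => h1 i j
    _ = η * p * (x ⬝ᵥ x) := by
        simp only [← Finset.mul_sum, ← Finset.sum_div, Finset.sum_add_distrib, Finset.sum_const,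
          Finset.card_univ, Fintype.card_fin, nsmul_eq_mul, dotProduct]
        simp only [mul_left_comm _ (p : ℝ), ← Finset.mul_sum]
        ring

lemma eventually_coercive {p : ℕ} {X : (n : ℕ) → Matrix (Fin n) (Fin p) ℝ}
    {S : Matrix (Fin p) (Fin p) ℝ} (hS : S.PosDef)
    (hX : Tendsto (fun n : ℕ => ((n : ℝ)⁻¹) • ((X n)ᵀ * X n)) atTop (nhds S)) :
    ∃ c : ℝ, 0 < c ∧ ∀ᶠ n : ℕ in atTop, ∀ x : Fin p → ℝ,
      c * n * (x ⬝ᵥ x) ≤ (X n *ᵥ x) ⬝ᵥ (X n *ᵥ x) := by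
  obtain ⟨c, hc, h⟩ := exists_coercive_of_posDef hS
  have hη : 0 < c / (2 * (p + 1)) := by positivity
  have hent : ∀ᶠ n : ℕ in atTop, ∀ i j,
      |(((n : ℝ)⁻¹) • ((X n)ᵀ * X n) - S) i j| ≤ c / (2 * (p + 1)) := by
    refine eventually_all.2 fun i => eventually_all.2 fun j => ?_
    have hij := tendsto_pi_nhds.1 (tendsto_pi_nhds.1 hX i) j
    filter_upwards [Metric.tendsto_nhds.1 hij _ hη] with n hn
    exact (by simpa [Real.dist_eq] using hn.le)
  refine ⟨c / 2, by positivity, ?_⟩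
  filter_upwards [hent, eventually_gt_atTop 0] with n hn hn0 x
  have hn0' : (0 : ℝ) < n := by exact_mod_cast hn0
  have hxx : 0 ≤ x ⬝ᵥ x := by simpa using dotProduct_star_self_nonneg x
  have h1 := (abs_le.1 (abs_dotProduct_mulVec_le hn x)).1
  rw [sub_mulVec, dotProduct_sub, smul_mulVec, dotProduct_smul, smul_eq_mul] at h1
  have h2 : x ⬝ᵥ ((X n)ᵀ * X n) *ᵥ x = (X n *ᵥ x) ⬝ᵥ (X n *ᵥ x) := by
    rw [← mulVec_mulVec, dotProduct_mulVec, vecMul_transpose]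
  rw [h2] at h1
  have h3 : c / (2 * (p + 1)) * p ≤ c / 2 := by
    rw [div_mul_eq_mul_div, div_le_div_iff₀ (by positivity) (by positivity)]
    nlinarith
  have h4 : c / 2 * (x ⬝ᵥ x) ≤ (n : ℝ)⁻¹ * ((X n *ᵥ x) ⬝ᵥ (X n *ᵥ x)) := by
    nlinarith [h x, mul_le_mul_of_nonneg_right h3 hxx]
  calc c / 2 * n * (x ⬝ᵥ x) = n * (c / 2 * (x ⬝ᵥ x)) := by ring
    _ ≤ n * ((n : ℝ)⁻¹ * ((X n *ᵥ x) ⬝ᵥ (X n *ᵥ x))) := by gcongr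
    _ = _ := by field_simp

section Projector

variable {n p : ℕ} {X : Matrix (Fin n) (Fin p) ℝ}

lemma designSub_mulVec (X : Matrix (Fin n) (Fin p) ℝ) (γ : Finset (Fin p))
    (b : {j // j ∈ γ} → ℝ) :
    designSub X γ *ᵥ b = X *ᵥ fun j => if h : j ∈ γ then b ⟨j, h⟩ else 0 := by
  ext i
  simp only [mulVec, dotProduct, designSub, of_apply]
  rw [← Finset.sum_subset (Finset.subset_univ γ), ← Finset.sum_coe_sort γ]
  · refine Finset.sum_congr rfl fun j _ => ?_
    simp
  · intro j _ hj
    simp [hj]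

lemma isUnit_det_gram_designSub (hX : ∀ x : Fin p → ℝ, X *ᵥ x = 0 → x = 0)
    (γ : Finset (Fin p)) : IsUnit ((designSub X γ)ᵀ * designSub X γ).det := by
  rw [isUnit_iff_ne_zero]
  intro h0
  obtain ⟨v, hv, hGv⟩ := exists_mulVec_eq_zero_iff.2 h0
  apply hv
  have h1 : (designSub X γ *ᵥ v) ⬝ᵥ (designSub X γ *ᵥ v) = 0 := by
    have : v ⬝ᵥ ((designSub X γ)ᵀ * designSub X γ) *ᵥ v = 0 := by rw [hGv, dotProduct_zero]
    rwa [← mulVec_mulVec, dotProduct_mulVec, vecMul_transpose] at this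
  have h2 := dotProduct_self_eq_zero.1 h1
  rw [designSub_mulVec] at h2
  have h3 := hX _ h2
  ext j
  simpa using congrFun h3 j

lemma transpose_hatMatrix (γ : Finset (Fin p)) : (hatMatrix X γ)ᵀ = hatMatrix X γ := by
  simp [hatMatrix, transpose_nonsing_inv, Matrix.mul_assoc]

lemma hatMatrix_mul_designSub (hX : ∀ x : Fin p → ℝ, X *ᵥ x = 0 → x = 0)
    (γ : Finset (Fin p)) : hatMatrix X γ * designSub X γ = designSub X γ := by
  rw [hatMatrix, Matrix.mul_assoc, Matrix.mul_assoc,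
    nonsing_inv_mul _ (isUnit_det_gram_designSub hX γ), Matrix.mul_one]

lemma hatMatrix_mul_self (hX : ∀ x : Fin p → ℝ, X *ᵥ x = 0 → x = 0)
    (γ : Finset (Fin p)) : hatMatrix X γ * hatMatrix X γ = hatMatrix X γ := by
  conv_lhs => rw [hatMatrix, ← Matrix.mul_assoc, ← Matrix.mul_assoc, ← hatMatrix,
    hatMatrix_mul_designSub hX]
  rfl

lemma trace_hatMatrix (hX : ∀ x : Fin p → ℝ, X *ᵥ x = 0 → x = 0)
    (γ : Finset (Fin p)) : (hatMatrix X γ).trace = γ.card := by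
  rw [hatMatrix, Matrix.mul_assoc, trace_mul_comm, Matrix.mul_assoc,
    nonsing_inv_mul _ (isUnit_det_gram_designSub hX γ), trace_one]
  simp

lemma hatMatrix_mulVec_one (horth : ∀ j, ∑ i, X i j = 0) (γ : Finset (Fin p)) :
    hatMatrix X γ *ᵥ 1 = 0 := by
  have : (designSub X γ)ᵀ *ᵥ 1 = 0 := by
    ext j
    simpa [mulVec, dotProduct, designSub] using horth j
  rw [hatMatrix, ← mulVec_mulVec, this, mulVec_zero]

lemma hatMatrix_mulVec_mulVec (hX : ∀ x : Fin p → ℝ, X *ᵥ x = 0 → x = 0)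
    {γ : Finset (Fin p)} {β : Fin p → ℝ} (hβ : ∀ j ∉ γ, β j = 0) :
    hatMatrix X γ *ᵥ (X *ᵥ β) = X *ᵥ β := by
  have h : X *ᵥ β = designSub X γ *ᵥ fun j => β j := by
    rw [designSub_mulVec]
    congr 1
    ext j
    by_cases hj : j ∈ γ <;> simp [hj, hβ]
  rw [h, mulVec_mulVec, hatMatrix_mul_designSub hX]

lemma dotProduct_hatMatrix_mulVec (hX : ∀ x : Fin p → ℝ, X *ᵥ x = 0 → x = 0)
    (γ : Finset (Fin p)) (u : Fin n → ℝ) :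
    u ⬝ᵥ hatMatrix X γ *ᵥ u = (hatMatrix X γ *ᵥ u) ⬝ᵥ (hatMatrix X γ *ᵥ u) := by
  conv_lhs => rw [← hatMatrix_mul_self hX, ← mulVec_mulVec, dotProduct_mulVec,
    ← mulVec_transpose, transpose_hatMatrix]

lemma dotProduct_hatMatrix_mulVec_nonneg (hX : ∀ x : Fin p → ℝ, X *ᵥ x = 0 → x = 0)
    (γ : Finset (Fin p)) (u : Fin n → ℝ) : 0 ≤ u ⬝ᵥ hatMatrix X γ *ᵥ u := by
  rw [dotProduct_hatMatrix_mulVec hX]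
  simpa using dotProduct_star_self_nonneg (hatMatrix X γ *ᵥ u)

lemma residProj_mulVec_dotProduct_self (hX : ∀ x : Fin p → ℝ, X *ᵥ x = 0 → x = 0)
    (γ : Finset (Fin p)) (u : Fin n → ℝ) :
    (residProj X γ *ᵥ u) ⬝ᵥ (residProj X γ *ᵥ u) = u ⬝ᵥ u - u ⬝ᵥ hatMatrix X γ *ᵥ u := by
  rw [residProj_eq_one_sub_hatMatrix, sub_mulVec, one_mulVec, sub_dotProduct, dotProduct_sub,
    dotProduct_sub, ← dotProduct_hatMatrix_mulVec hX, dotProduct_comm (hatMatrix X γ *ᵥ u) u]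
  ring

lemma hatMatrix_mulVec_residProj_mulVec (hX : ∀ x : Fin p → ℝ, X *ᵥ x = 0 → x = 0)
    (γ : Finset (Fin p)) (u : Fin n → ℝ) :
    hatMatrix X γ *ᵥ (residProj X γ *ᵥ u) = 0 := by
  rw [residProj_eq_one_sub_hatMatrix, mulVec_mulVec, Matrix.mul_sub, Matrix.mul_one,
    hatMatrix_mul_self hX, sub_self, zero_mulVec]

lemma one_dotProduct_mulVec_of_orth (horth : ∀ j, ∑ i, X i j = 0) (β : Fin p → ℝ) :
    (1 : Fin n → ℝ) ⬝ᵥ (X *ᵥ β) = 0 := by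
  rw [dotProduct_mulVec]
  have : (1 : Fin n → ℝ) ᵥ* X = 0 := by
    ext j
    simpa [vecMul, dotProduct] using horth j
  rw [this, zero_dotProduct]

lemma le_residProj_mulVec_dotProduct_self {a : ℝ} (ha : 0 ≤ a)
    (hX : ∀ x : Fin p → ℝ, a * (x ⬝ᵥ x) ≤ (X *ᵥ x) ⬝ᵥ (X *ᵥ x))
    {γ : Finset (Fin p)} (β : Fin p → ℝ) {j : Fin p} (hj : j ∉ γ) :
    a * β j ^ 2 ≤ (residProj X γ *ᵥ (X *ᵥ β)) ⬝ᵥ (residProj X γ *ᵥ (X *ᵥ β)) := by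
  set b := (((designSub X γ)ᵀ * designSub X γ)⁻¹ * (designSub X γ)ᵀ) *ᵥ (X *ᵥ β) with hb
  have h : residProj X γ *ᵥ (X *ᵥ β) =
      X *ᵥ (β - fun j => if h : j ∈ γ then b ⟨j, h⟩ else 0) := by
    rw [mulVec_sub, ← designSub_mulVec, hb, mulVec_mulVec (M := designSub X γ),
      ← Matrix.mul_assoc, residProj, sub_mulVec, one_mulVec]
  rw [h]
  refine le_trans ?_ (hX _)
  refine mul_le_mul_of_nonneg_left ?_ ha
  have := Finset.single_le_sum (f := fun i => (β - fun j => if h : j ∈ γ then b ⟨j, h⟩ else 0) i *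
    (β - fun j => if h : j ∈ γ then b ⟨j, h⟩ else 0) i)
    (fun i _ => mul_self_nonneg _) (Finset.mem_univ j)
  simpa [hj, dotProduct, sq] using this

lemma yResp_sub_mean (hn : 0 < n) (horth : ∀ j, ∑ i, X i j = 0) (α σ : ℝ) (β : Fin p → ℝ)
    (e : Fin n → ℝ) :
    (fun i => yResp X α β σ e i - (∑ l, yResp X α β σ e l) / n) =
      X *ᵥ β + σ • (e - ((∑ l, e l) / n) • (1 : Fin n → ℝ)) := by
  have h1 := one_dotProduct_mulVec_of_orth horth β
  have hn' : (n : ℝ) ≠ 0 := by exact_mod_cast hn.ne'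
  rw [one_dotProduct] at h1
  have h2 : ∑ l, yResp X α β σ e l = n * α + σ * ∑ l, e l := by
    simp [yResp, Finset.sum_add_distrib, h1, Finset.mul_sum]
  ext i
  rw [h2]
  simp only [yResp, Pi.add_apply, Pi.smul_apply, Pi.sub_apply, Pi.one_apply, smul_eq_mul]
  field_simp
  ring

lemma one_sub_RsqC (X : Matrix (Fin n) (Fin p) ℝ) (γ : Finset (Fin p)) (y : Fin n → ℝ) :
    1 - RsqC X γ y =
      ((residProj X γ *ᵥ fun j => y j - (∑ l, y l) / n) ⬝ᵥ
        (residProj X γ *ᵥ fun j => y j - (∑ l, y l) / n)) /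
      (∑ i, (y i - (∑ l, y l) / n) ^ 2) := by
  simp [RsqC, dotProduct, sq]

lemma center_dotProduct_self_le (e : Fin n → ℝ) :
    (e - ((∑ l, e l) / n) • (1 : Fin n → ℝ)) ⬝ᵥ (e - ((∑ l, e l) / n) • (1 : Fin n → ℝ))
      ≤ e ⬝ᵥ e := by
  rcases Nat.eq_zero_or_pos n with rfl | hn
  · simp [dotProduct]
  have hn' : (0 : ℝ) < n := by exact_mod_cast hn
  have h : (e - ((∑ l, e l) / n) • (1 : Fin n → ℝ)) ⬝ᵥ
      (e - ((∑ l, e l) / n) • (1 : Fin n → ℝ)) = e ⬝ᵥ e - (∑ l, e l) ^ 2 / n := by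
    simp only [sub_dotProduct, dotProduct_sub, smul_dotProduct, dotProduct_smul, one_dotProduct,
      dotProduct_one, smul_eq_mul, Pi.one_apply, Pi.sub_apply, Pi.smul_apply,
      Finset.sum_sub_distrib, Finset.sum_const, Finset.card_univ, Fintype.card_fin, nsmul_eq_mul]
    field_simp
    ring
  rw [h]
  have : 0 ≤ (∑ l, e l) ^ 2 / n := by positivity
  linarith

lemma residProj_sq_true_model_le (hX : ∀ x : Fin p → ℝ, X *ᵥ x = 0 → x = 0)
    {T : Finset (Fin p)} {β : Fin p → ℝ} (hβ : ∀ j ∉ T, β j = 0) (σ : ℝ) (e : Fin n → ℝ) :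
    (residProj X T *ᵥ (X *ᵥ β + σ • e)) ⬝ᵥ (residProj X T *ᵥ (X *ᵥ β + σ • e))
      ≤ σ ^ 2 * (e ⬝ᵥ e) := by
  have h : residProj X T *ᵥ (X *ᵥ β + σ • e) = σ • (residProj X T *ᵥ e) := by
    rw [mulVec_add, mulVec_smul, residProj_eq_one_sub_hatMatrix, sub_mulVec, one_mulVec,
      hatMatrix_mulVec_mulVec hX hβ, sub_self, zero_add]
  rw [h, smul_dotProduct, dotProduct_smul, residProj_mulVec_dotProduct_self hX, smul_eq_mul,
    smul_eq_mul]
  nlinarith [mul_nonneg (sq_nonneg σ) (dotProduct_hatMatrix_mulVec_nonneg hX T e)]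

lemma residProj_sq_true_add_le (hX : ∀ x : Fin p → ℝ, X *ᵥ x = 0 → x = 0)
    (horth : ∀ j, ∑ i, X i j = 0)
    {T : Finset (Fin p)} {β : Fin p → ℝ} (hβ : ∀ j ∉ T, β j = 0) (γ : Finset (Fin p))
    (σ t : ℝ) (e : Fin n → ℝ) :
    let v := X *ᵥ β + σ • (e - t • (1 : Fin n → ℝ))
    let m := residProj X γ *ᵥ (X *ᵥ β)
    (residProj X T *ᵥ v) ⬝ᵥ (residProj X T *ᵥ v) +
        (m ⬝ᵥ m + 2 * σ * (m ⬝ᵥ e) - σ ^ 2 * (e ⬝ᵥ hatMatrix X γ *ᵥ e))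
      ≤ (residProj X γ *ᵥ v) ⬝ᵥ (residProj X γ *ᵥ v) := by
  intro v m
  set f := e - t • (1 : Fin n → ℝ) with hf
  have hT : residProj X T *ᵥ v = σ • (residProj X T *ᵥ f) := by
    simp only [v]
    rw [mulVec_add, mulVec_smul, residProj_eq_one_sub_hatMatrix, sub_mulVec, one_mulVec,
      hatMatrix_mulVec_mulVec hX hβ, sub_self, zero_add]
  have hγ : residProj X γ *ᵥ v = m + σ • (residProj X γ *ᵥ f) := by
    simp only [v, m]
    rw [mulVec_add, mulVec_smul]
  have hm1 : m ⬝ᵥ (1 : Fin n → ℝ) = 0 := by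
    simp only [m]
    rw [residProj_eq_one_sub_hatMatrix, sub_mulVec, one_mulVec, sub_dotProduct,
      dotProduct_comm, one_dotProduct_mulVec_of_orth horth, dotProduct_comm, dotProduct_mulVec,
      ← mulVec_transpose, transpose_hatMatrix, hatMatrix_mulVec_one horth]
    simp
  have hHf : hatMatrix X γ *ᵥ f = hatMatrix X γ *ᵥ e := by
    rw [hf, mulVec_sub, mulVec_smul, hatMatrix_mulVec_one horth]
    simp
  have hfe : f ⬝ᵥ hatMatrix X γ *ᵥ f = e ⬝ᵥ hatMatrix X γ *ᵥ e := by
    rw [dotProduct_hatMatrix_mulVec hX, hHf, ← dotProduct_hatMatrix_mulVec hX]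
  have hmQ : m ⬝ᵥ residProj X γ *ᵥ f = m ⬝ᵥ e := by
    rw [residProj_eq_one_sub_hatMatrix, sub_mulVec, one_mulVec, dotProduct_sub, dotProduct_mulVec,
      ← mulVec_transpose, transpose_hatMatrix, hatMatrix_mulVec_residProj_mulVec hX, hf,
      dotProduct_sub, dotProduct_smul, hm1]
    simp
  rw [hT, hγ]
  simp only [add_dotProduct, dotProduct_add, smul_dotProduct, dotProduct_smul, smul_eq_mul]
  rw [dotProduct_comm (residProj X γ *ᵥ f) m, hmQ, residProj_mulVec_dotProduct_self hX T,
    residProj_mulVec_dotProduct_self hX γ f, hfe]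
  nlinarith [mul_nonneg (sq_nonneg σ) (dotProduct_hatMatrix_mulVec_nonneg hX T f)]

end Projector

section Moments

variable {Ω : Type*} [MeasurableSpace Ω] {P : Measure Ω} {n : ℕ} {ε : Ω → Fin n → ℝ}

lemma integrable_mul_of_cov_eq_one (hmeas : Measurable ε)
    (hcov : ∀ i j, ∫ ω, ε ω i * ε ω j ∂P = if i = j then 1 else 0) (i j : Fin n) :
    Integrable (fun ω => ε ω i * ε ω j) P := by
  have hL : ∀ i, MemLp (fun ω => ε ω i) 2 P := fun i => by
    refine (memLp_two_iff_integrable_sq ((measurable_pi_apply i).comp hmeas).aestronglyMeasurable).2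
      ?_
    by_contra h
    have h1 := hcov i i
    change ¬Integrable (fun ω => ε ω i ^ 2) P at h
    simp only [← sq] at h1
    rw [integral_undef h] at h1
    simp at h1
  exact (hL i).integrable_mul (hL j)

lemma integrable_quadForm (hmeas : Measurable ε)
    (hcov : ∀ i j, ∫ ω, ε ω i * ε ω j ∂P = if i = j then 1 else 0)
    (A : Matrix (Fin n) (Fin n) ℝ) : Integrable (fun ω => ε ω ⬝ᵥ A *ᵥ ε ω) P := by
  have h : (fun ω => ε ω ⬝ᵥ A *ᵥ ε ω) = fun ω => ∑ i, ∑ j, A i j * (ε ω i * ε ω j) := by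
    ext ω
    simp only [dotProduct, mulVec, Finset.mul_sum]
    exact Finset.sum_congr rfl fun i _ => Finset.sum_congr rfl fun j _ => by ring
  rw [h]
  exact integrable_finsetSum _ fun i _ => integrable_finsetSum _ fun j _ =>
    (integrable_mul_of_cov_eq_one hmeas hcov i j).const_mul _

lemma integral_quadForm (hmeas : Measurable ε)
    (hcov : ∀ i j, ∫ ω, ε ω i * ε ω j ∂P = if i = j then 1 else 0)
    (A : Matrix (Fin n) (Fin n) ℝ) : ∫ ω, ε ω ⬝ᵥ A *ᵥ ε ω ∂P = A.trace := by
  have h : (fun ω => ε ω ⬝ᵥ A *ᵥ ε ω) = fun ω => ∑ i, ∑ j, A i j * (ε ω i * ε ω j) := by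
    ext ω
    simp only [dotProduct, mulVec, Finset.mul_sum]
    exact Finset.sum_congr rfl fun i _ => Finset.sum_congr rfl fun j _ => by ring
  have hI := fun i j => (integrable_mul_of_cov_eq_one hmeas hcov i j).const_mul (A i j)
  rw [h, integral_finsetSum _ fun i _ => integrable_finsetSum _ fun j _ => hI i j]
  simp_rw [integral_finsetSum _ fun j _ => hI _ j, integral_const_mul, hcov]
  simp [trace]

lemma ofReal_lt_prob_quadForm_lt_one [IsProbabilityMeasure P] (hmeas : Measurable ε)
    (hcov : ∀ i j, ∫ ω, ε ω i * ε ω j ∂P = if i = j then 1 else 0)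
    {A : Matrix (Fin n) (Fin n) ℝ} (hA : ∀ x, 0 ≤ x ⬝ᵥ A *ᵥ x) {k : ℝ} (hk1 : k < 1)
    (htr : A.trace < k) :
    ENNReal.ofReal (1 - k) < P {ω | ε ω ⬝ᵥ A *ᵥ ε ω < 1} := by
  have hM := mul_meas_ge_le_integral_of_nonneg (ae_of_all P fun ω => hA (ε ω))
    (integrable_quadForm hmeas hcov A) 1
  rw [integral_quadForm hmeas hcov, one_mul] at hM
  have hcont : Continuous fun x : Fin n → ℝ => x ⬝ᵥ A *ᵥ x := by fun_prop
  have hset : MeasurableSet {ω | 1 ≤ ε ω ⬝ᵥ A *ᵥ ε ω} :=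
    measurableSet_le measurable_const (hcont.measurable.comp hmeas)
  have hc : {ω | ε ω ⬝ᵥ A *ᵥ ε ω < 1} = {ω | 1 ≤ ε ω ⬝ᵥ A *ᵥ ε ω}ᶜ := by
    ext ω
    simp
  rw [ENNReal.ofReal_lt_iff_lt_toReal (by linarith) (measure_ne_top _ _), hc]
  change _ < P.real _
  rw [probReal_compl_eq_one_sub hset]
  linarith

end Moments

lemma div_div_div_lt_one_sub {A B D c s : ℝ} (hc : 1 < c) (hA : 0 ≤ A) (hs : 0 < s)
    (hAs : A ≤ s * (c - 1)) (hB : A + s < B) : A / D / (B / D) < 1 - 1 / c := by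
  have hc0 : 0 < c := by linarith
  have hc' : 1 / c < 1 := by rw [div_lt_one hc0]; exact hc
  by_cases hD : D = 0
  · simpa [hD] using hc'
  · have hBpos : 0 < B := by linarith
    rw [div_div_div_cancel_right₀ hD, div_lt_iff₀ hBpos]
    have : (1 - 1 / c) * B = (c - 1) * B / c := by field_simp
    rw [this, lt_div_iff₀ hc0]
    nlinarith

lemma Rsq_ratio_lt {n p : ℕ} {X : Matrix (Fin n) (Fin p) ℝ} (hn : 0 < n)
    (hX : ∀ x : Fin p → ℝ, X *ᵥ x = 0 → x = 0) (horth : ∀ j, ∑ i, X i j = 0)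
    {T : Finset (Fin p)} {β : Fin p → ℝ} (hβ : ∀ j ∉ T, β j = 0) (γ : Finset (Fin p))
    {α σ a M : ℝ} (hσ : 0 < σ) (ha : 0 < a) (hM : 0 < M)
    (hm : a * n ≤ (residProj X γ *ᵥ (X *ᵥ β)) ⬝ᵥ (residProj X γ *ᵥ (X *ᵥ β)))
    {e : Fin n → ℝ} (he : e ⬝ᵥ e ≤ M * n)
    (hme : 64 * σ ^ 2 * ((residProj X γ *ᵥ (X *ᵥ β)) ⬝ᵥ e) ^ 2 <
      ((residProj X γ *ᵥ (X *ᵥ β)) ⬝ᵥ (residProj X γ *ᵥ (X *ᵥ β))) ^ 2)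
    (hHe : 4 * σ ^ 2 * (e ⬝ᵥ hatMatrix X γ *ᵥ e) <
      (residProj X γ *ᵥ (X *ᵥ β)) ⬝ᵥ (residProj X γ *ᵥ (X *ᵥ β))) :
    (1 - RsqC X T (yResp X α β σ e)) / (1 - RsqC X γ (yResp X α β σ e)) <
      1 - 1 / (1 + 2 * σ ^ 2 * M / a) := by
  have hn' : (0 : ℝ) < n := by exact_mod_cast hn
  rw [one_sub_RsqC, one_sub_RsqC, yResp_sub_mean hn horth]
  set t := (∑ l, e l) / n with ht
  have h1 := residProj_sq_true_add_le hX horth hβ γ σ t e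
  have h2 := (residProj_sq_true_model_le hX hβ σ (e - t • (1 : Fin n → ℝ))).trans
    (mul_le_mul_of_nonneg_left ((center_dotProduct_self_le e).trans he) (sq_nonneg σ))
  simp only at h1
  set m := residProj X γ *ᵥ (X *ᵥ β) with hmdef
  have hmm : 0 < m ⬝ᵥ m := lt_of_lt_of_le (by positivity) hm
  have h3 : -(m ⬝ᵥ m) < 8 * σ * (m ⬝ᵥ e) := by
    have : (8 * σ * (m ⬝ᵥ e)) ^ 2 < (m ⬝ᵥ m) ^ 2 := by nlinarith
    exact (abs_lt.1 ((sq_lt_sq.1 this).trans_eq (abs_of_pos hmm))).1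
  refine div_div_div_lt_one_sub (s := a * n / 2) ?_ ?_ (by positivity) ?_ ?_
  · have : 0 < 2 * σ ^ 2 * M / a := by positivity
    linarith
  · simpa using dotProduct_star_self_nonneg
      (residProj X T *ᵥ (X *ᵥ β + σ • (e - t • (1 : Fin n → ℝ))))
  · refine h2.trans (le_of_eq ?_)
    field_simp
    ring
  · nlinarith

/-- **Lemma 3, part 3.** For `γ ⊉ T` (with `T` nonempty), the ratio
`(1-R_T²)/(1-R_γ²)` is bounded away from `1` (strictly below) in probability, uniformly
in large `n`. -/
theorem Rsq_ratio_nonsupset_small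
    (p : ℕ) (hp : 1 ≤ p)
    (Ω : Type) [MeasurableSpace Ω] (P : Measure Ω) [IsProbabilityMeasure P]
    (X : (n : ℕ) → Matrix (Fin n) (Fin p) ℝ)
    (ε : (n : ℕ) → Ω → Fin n → ℝ)
    (horth : ∀ n j, ∑ i, X n i j = 0)
    (hA2 : ∃ S₀ : Matrix (Fin p) (Fin p) ℝ, S₀.PosDef ∧
      Tendsto (fun n : ℕ => ((n : ℝ)⁻¹) • ((X n)ᵀ * X n)) atTop (nhds S₀))
    (hmeas : ∀ n, Measurable (ε n))
    (hsph : ∀ (n : ℕ) (O : Matrix (Fin n) (Fin n) ℝ), Oᵀ * O = 1 →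
      P.map (fun ω => O.mulVec (ε n ω)) = P.map (ε n))
    (hmean : ∀ n i, ∫ ω, ε n ω i ∂P = 0)
    (hcov : ∀ n i j, ∫ ω, ε n ω i * ε n ω j ∂P = if i = j then 1 else 0)
    (hA1 : ∀ c : ℝ, 0 < c → ∃ M : ℝ, 1 < M ∧ ∀ n : ℕ, 0 < n →
      ENNReal.ofReal (1 - c) <
        P {ω | M⁻¹ < (∑ i, ε n ω i ^ 2) / n ∧ (∑ i, ε n ω i ^ 2) / n < M})
    (T : Finset (Fin p)) (αT σT : ℝ) (hσ : 0 < σT)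
    (βT : Fin p → ℝ) (hβT : ∀ j ∈ T, βT j ≠ 0) (hβT' : ∀ j ∉ T, βT j = 0)
    (hT : T.Nonempty) (γ : Finset (Fin p)) (hγ : ¬ T ⊆ γ)
    :
    (∀ k : ℝ, 0 < k → k < 1 → ∃ c : ℝ, 1 < c ∧ ∃ N : ℕ, ∀ n, N ≤ n →
      ENNReal.ofReal (1 - k) <
        P {ω | (1 - RsqC (X n) T (yResp (X n) αT βT σT (ε n ω))) / (1 - RsqC (X n) γ (yResp (X n) αT βT σT (ε n ω))) < 1 - 1 / c}) := by
  intro k hk hk1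
  obtain ⟨S₀, hS₀, hlim⟩ := hA2
  obtain ⟨l, hl, hev⟩ := eventually_coercive hS₀ hlim
  obtain ⟨j, hjT, hjγ⟩ := Finset.not_subset.1 hγ
  set a := l * βT j ^ 2 with hadef
  have ha : 0 < a := by
    have := hβT j hjT
    positivity
  set M := 2 / k with hMdef
  have hM : 0 < M := by positivity
  have hK : 0 < 2 * σT ^ 2 * M / a := by positivity
  refine ⟨1 + 2 * σT ^ 2 * M / a, by linarith, ?_⟩
  rw [← eventually_atTop]
  have hbig : ∀ᶠ n : ℕ in atTop, (64 + 4 * γ.card) * σT ^ 2 / (a * (k / 2)) < (n : ℝ) :=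
    tendsto_natCast_atTop_atTop.eventually_gt_atTop _
  filter_upwards [hev, hbig, eventually_gt_atTop 0] with n hco hnb hn
  have hn' : (0 : ℝ) < n := by exact_mod_cast hn
  have hX : ∀ x : Fin p → ℝ, X n *ᵥ x = 0 → x = 0 := fun x hx => by
    have h := hco x
    rw [hx, zero_dotProduct] at h
    have h0 : 0 ≤ x ⬝ᵥ x := by simpa using dotProduct_star_self_nonneg x
    refine dotProduct_self_eq_zero.1 (le_antisymm ?_ h0)
    by_contra! hlt
    have : 0 < l * n * (x ⬝ᵥ x) := by positivity
    linarith
  have hm : a * n ≤ (residProj (X n) γ *ᵥ (X n *ᵥ βT)) ⬝ᵥ (residProj (X n) γ *ᵥ (X n *ᵥ βT)) := by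
    have := le_residProj_mulVec_dotProduct_self (by positivity) hco βT hjγ
    refine le_trans (le_of_eq ?_) this
    rw [hadef]
    ring
  set m := residProj (X n) γ *ᵥ (X n *ᵥ βT) with hmdef
  have hmm : 0 < m ⬝ᵥ m := lt_of_lt_of_le (by positivity) hm
  set A : Matrix (Fin n) (Fin n) ℝ := (1 / (M * n)) • (1 : Matrix (Fin n) (Fin n) ℝ) +
    (64 * σT ^ 2 / (m ⬝ᵥ m) ^ 2) • vecMulVec m m +
    (4 * σT ^ 2 / (m ⬝ᵥ m)) • hatMatrix (X n) γ with hAdef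
  have hquad : ∀ x : Fin n → ℝ, x ⬝ᵥ A *ᵥ x = (x ⬝ᵥ x) / (M * n) +
      64 * σT ^ 2 * (m ⬝ᵥ x) ^ 2 / (m ⬝ᵥ m) ^ 2 +
      4 * σT ^ 2 * (x ⬝ᵥ hatMatrix (X n) γ *ᵥ x) / (m ⬝ᵥ m) := fun x => by
    have hv : x ⬝ᵥ vecMulVec m m *ᵥ x = (m ⬝ᵥ x) ^ 2 := by
      rw [vecMulVec_mulVec, dotProduct_smul, dotProduct_comm x m]
      simp [sq]
    rw [hAdef, add_mulVec, add_mulVec, smul_mulVec, smul_mulVec, smul_mulVec, one_mulVec,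
      dotProduct_add, dotProduct_add, dotProduct_smul, dotProduct_smul, dotProduct_smul, hv]
    simp only [smul_eq_mul]
    ring
  have hxx : ∀ x : Fin n → ℝ, 0 ≤ (x ⬝ᵥ x) / (M * n) := fun x =>
    div_nonneg (by simpa using dotProduct_star_self_nonneg x) (by positivity)
  have hmx : ∀ x : Fin n → ℝ, 0 ≤ 64 * σT ^ 2 * (m ⬝ᵥ x) ^ 2 / (m ⬝ᵥ m) ^ 2 :=
    fun x => by positivity
  have hHx : ∀ x : Fin n → ℝ,
      0 ≤ 4 * σT ^ 2 * (x ⬝ᵥ hatMatrix (X n) γ *ᵥ x) / (m ⬝ᵥ m) := fun x =>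
    div_nonneg (mul_nonneg (by positivity) (dotProduct_hatMatrix_mulVec_nonneg hX γ x)) hmm.le
  have htr : A.trace < k := by
    have h1 : A.trace = k / 2 + (64 + 4 * γ.card) * σT ^ 2 / (m ⬝ᵥ m) := by
      rw [hAdef, trace_add, trace_add, trace_smul, trace_smul, trace_smul, trace_one,
        trace_vecMulVec, trace_hatMatrix hX, Fintype.card_fin, hMdef]
      simp only [smul_eq_mul]
      field_simp
      ring
    have h2 : (64 + 4 * γ.card) * σT ^ 2 / (m ⬝ᵥ m) < k / 2 := by
      rw [div_lt_iff₀ (by positivity)] at hnb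
      rw [div_lt_iff₀ hmm]
      nlinarith
    linarith
  refine (ofReal_lt_prob_quadForm_lt_one (hmeas n) (hcov n)
    (fun x => by rw [hquad]; linarith [hxx x, hmx x, hHx x]) hk1 htr).trans_le
    (measure_mono fun ω hω => ?_)
  simp only [Set.mem_ofPred_eq, hquad] at hω ⊢
  have h1 := hxx (ε n ω)
  have h2 := hmx (ε n ω)
  have h3 := hHx (ε n ω)
  refine Rsq_ratio_lt hn hX (horth n) hβT' γ hσ ha hM hm ?_ ?_ ?_
  · rw [← div_le_one (by positivity)]
    linarith
  · rw [← hmdef, ← div_lt_one (by positivity)]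
    linarith
  · rw [← hmdef, ← div_lt_one hmm]
    linarith
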